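/- Let n, f, b, r be natural numbers, let A_1, …, A_n ∈ ℝ^{f×b}, let Z ∈ ℝ^{n×n}, and let λ ∈ ℝ. For each pair (i,j) set K_{ij} = A_iᵀ A_j ∈ ℝ^{b×b}, and define H₁ = Σ_{i=1}^n K_{ii}, H₂ = Σ_{s=1}^n Σ_{t=1}^n (Σ_{i=1}^n Z_{si} Z_{ti}) · K_{st}, and H₃ = Σ_{i=1}^n Σ_{j=1}^n Z_{ji} · (K_{ij} + K_{ji}). Then for every P ∈ ℝ^{b×r} with Pᵀ P = I_r, one has Σ_{i=1}^n ( ‖A_i P − Σ_{j=1}^n A_j P Z_{ji}‖_F² + λ ‖A_i − A_i P Pᵀ‖_F² ) = Tr( Pᵀ ( (1 − λ) H₁ + H₂ − H₃ ) P ) + λ · Σ_{i=1}^n Tr(K_{ii}). -/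

import Mathlib

open Matrix

/-- Squared Frobenius norm of a real matrix. -/
noncomputable def frobSq {α β : Type*} [Fintype α] [Fintype β]
    (M : Matrix α β ℝ) : ℝ := ∑ i, ∑ j, (M i j) ^ 2

theorem frobSq_eq_trace {α β : Type*} [Fintype α] [Fintype β] (M : Matrix α β ℝ) :
    frobSq M = (Mᵀ * M).trace := by
  simp only [frobSq, Matrix.trace, Matrix.diag, Matrix.mul_apply, Matrix.transpose_apply, sq]
  exact Finset.sum_comm

theorem frobSq_sub {α β : Type*} [Fintype α] [Fintype β] (M N : Matrix α β ℝ) :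
    frobSq (M - N) = (Mᵀ * M).trace - (Mᵀ * N).trace - (Nᵀ * M).trace + (Nᵀ * N).trace := by
  rw [frobSq_eq_trace, Matrix.transpose_sub, Matrix.sub_mul, Matrix.mul_sub, Matrix.mul_sub]
  simp only [Matrix.trace_sub]
  ring

theorem frobSq_sub_mul_mul_transpose {α β γ : Type*} [Fintype α] [Fintype β] [Fintype γ]
    [DecidableEq γ] (M : Matrix α β ℝ) (P : Matrix β γ ℝ) (hP : Pᵀ * P = 1) :
    frobSq (M - M * P * Pᵀ) = (Mᵀ * M).trace - (Pᵀ * (Mᵀ * M) * P).trace := by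
  have h₁ : (Mᵀ * (M * P * Pᵀ)).trace = (Pᵀ * (Mᵀ * M) * P).trace := by
    rw [← Matrix.mul_assoc, Matrix.trace_mul_comm]
    simp only [Matrix.mul_assoc]
  have h₂ : ((M * P * Pᵀ)ᵀ * M).trace = (Pᵀ * (Mᵀ * M) * P).trace := by
    rw [← Matrix.trace_transpose, Matrix.transpose_mul, Matrix.transpose_transpose, h₁]
  have h₃ : ((M * P * Pᵀ)ᵀ * (M * P * Pᵀ)).trace = (Pᵀ * (Mᵀ * M) * P).trace := by
    have h : (M * P * Pᵀ)ᵀ * (M * P * Pᵀ) = P * (Pᵀ * (Mᵀ * M) * P * Pᵀ) := by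
      simp only [Matrix.transpose_mul, Matrix.transpose_transpose, Matrix.mul_assoc]
    rw [h, Matrix.trace_mul_comm, Matrix.mul_assoc _ Pᵀ P, hP, Matrix.mul_one]
  rw [frobSq_sub, h₁, h₂, h₃]
  ring

theorem frobSq_mul_sub_sum {α β γ ι : Type*} [Fintype α] [Fintype β] [Fintype γ] [Fintype ι]
    (M : Matrix α β ℝ) (A : ι → Matrix α β ℝ) (z : ι → ℝ) (P : Matrix β γ ℝ) :
    frobSq (M * P - ∑ j, z j • (A j * P)) =
      (Pᵀ * (Mᵀ * M) * P).trace
        - ∑ j, z j * ((Pᵀ * (Mᵀ * A j) * P).trace + (Pᵀ * ((A j)ᵀ * M) * P).trace)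
        + ∑ s, ∑ t, z s * z t * (Pᵀ * ((A s)ᵀ * A t) * P).trace := by
  rw [frobSq_sub]
  simp only [Matrix.transpose_sum, Matrix.transpose_smul, Matrix.transpose_mul, Matrix.sum_mul,
    Matrix.mul_sum, Matrix.smul_mul, Matrix.mul_smul, Matrix.trace_sum, Matrix.trace_smul,
    smul_eq_mul, Matrix.mul_assoc, mul_add, Finset.sum_add_distrib, Finset.mul_sum]
  rw [Finset.sum_comm (f := fun s t => z s * (z t * _))]
  simp only [mul_assoc, mul_left_comm]
  ring

theorem stmt5 (n f b r : ℕ) (A : Fin n → Matrix (Fin f) (Fin b) ℝ)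
    (Z : Matrix (Fin n) (Fin n) ℝ) (lam : ℝ)
    (K : Fin n → Fin n → Matrix (Fin b) (Fin b) ℝ)
    (hK : ∀ i j, K i j = (A i)ᵀ * A j)
    (H1 H2 H3 : Matrix (Fin b) (Fin b) ℝ)
    (hH1 : H1 = ∑ i, K i i)
    (hH2 : H2 = ∑ s, ∑ t, (∑ i, Z s i * Z t i) • K s t)
    (hH3 : H3 = ∑ i, ∑ j, Z j i • (K i j + K j i))
    (P : Matrix (Fin b) (Fin r) ℝ) (hP : Pᵀ * P = 1) :
    ∑ i, (frobSq (A i * P - ∑ j, Z j i • (A j * P))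
        + lam * frobSq (A i - A i * P * Pᵀ)) =
    (Pᵀ * ((1 - lam) • H1 + H2 - H3) * P).trace
      + lam * ∑ i, (K i i).trace := by
  have hH1' : (Pᵀ * H1 * P).trace = ∑ i, (Pᵀ * K i i * P).trace := by
    simp only [hH1, Matrix.mul_sum, Matrix.sum_mul, Matrix.trace_sum]
  have hH2' : (Pᵀ * H2 * P).trace =
      ∑ i, ∑ s, ∑ t, Z s i * Z t i * (Pᵀ * K s t * P).trace := by
    simp only [hH2, Matrix.mul_sum, Matrix.sum_mul, Matrix.mul_smul, Matrix.smul_mul,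
      Matrix.trace_sum, Matrix.trace_smul, smul_eq_mul, Finset.sum_mul]
    symm
    rw [Finset.sum_comm]
    exact Finset.sum_congr rfl fun s _ => Finset.sum_comm
  have hH3' : (Pᵀ * H3 * P).trace =
      ∑ i, ∑ j, Z j i * ((Pᵀ * K i j * P).trace + (Pᵀ * K j i * P).trace) := by
    simp only [hH3, Matrix.mul_sum, Matrix.sum_mul, Matrix.mul_smul, Matrix.smul_mul,
      Matrix.mul_add, Matrix.add_mul, Matrix.trace_add, Matrix.trace_sum, Matrix.trace_smul,
      smul_eq_mul]
  have hsplit : (Pᵀ * ((1 - lam) • H1 + H2 - H3) * P).trace =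
      (1 - lam) * (Pᵀ * H1 * P).trace + (Pᵀ * H2 * P).trace - (Pᵀ * H3 * P).trace := by
    simp only [Matrix.mul_add, Matrix.add_mul, Matrix.mul_sub, Matrix.sub_mul, Matrix.mul_smul,
      Matrix.smul_mul, Matrix.trace_add, Matrix.trace_sub, Matrix.trace_smul, smul_eq_mul]
  rw [hsplit, hH1', hH2', hH3']
  simp only [frobSq_mul_sub_sum, frobSq_sub_mul_mul_transpose _ _ hP, ← hK,
    Finset.sum_add_distrib, Finset.sum_sub_distrib, ← Finset.mul_sum]
  ring
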